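/- K(22, 7) ≥ 234; that is, there exists a (22, 7) circuit code of length 234. -/

import Mathlib

/-- The cyclic distance between two positions on a cycle of length `N`:
the minimum of the two arc lengths. -/
def cycDist {N : ℕ} (i j : ZMod N) : ℕ := min (j - i).val (i - j).val

/-- `C` is an `(n,k)` circuit code of length `N`: a cyclic sequence of `N` distinct
vertices of the hypercube `I(n)` forming an induced cycle such that vertices at
Hamming distance `< k` are at equal cyclic distance. -/
structure IsCircuitCode (n k N : ℕ) (C : ZMod N → (Fin n → Bool)) : Prop where
  inj : Function.Injective C
  adj : ∀ i : ZMod N, hammingDist (C i) (C (i + 1)) = 1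
  induced : ∀ i j : ZMod N, i ≠ j → j ≠ i + 1 → i ≠ j + 1 →
    hammingDist (C i) (C j) ≠ 1
  spread : ∀ i j : ZMod N, hammingDist (C i) (C j) < k →
    cycDist i j = hammingDist (C i) (C j)

/-- There exists an `(n,k)` circuit code of length `N`. -/
def ExistsCircuitCode (n k N : ℕ) : Prop :=
  ∃ C : ZMod N → (Fin n → Bool), IsCircuitCode n k N C

/-- `K n k` is the maximum length of an `(n,k)` circuit code. -/
noncomputable def K (n k : ℕ) : ℕ := sSup {N | ExistsCircuitCode n k N}

/-- A code is determined by its spread (at least two) and the adjacency of consecutive vertices. -/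
theorem IsCircuitCode.of_adj_of_spread {n k N : ℕ} [NeZero N]
    {C : ZMod N → (Fin n → Bool)} (hk : 2 ≤ k)
    (adj : ∀ i : ZMod N, hammingDist (C i) (C (i + 1)) = 1)
    (spread : ∀ i j : ZMod N, hammingDist (C i) (C j) < k →
      cycDist i j = hammingDist (C i) (C j)) :
    IsCircuitCode n k N C where
  inj i j hij := by
    have h := spread i j (by rw [hij, hammingDist_self]; lia)
    rw [hij, hammingDist_self, cycDist] at h
    rcases min_eq_iff.mp h with ⟨h, -⟩ | ⟨h, -⟩
    · exact (sub_eq_zero.mp ((ZMod.val_eq_zero _).mp h)).symm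
    · exact sub_eq_zero.mp ((ZMod.val_eq_zero _).mp h)
  adj := adj
  induced i j _ hji hij h1 := by
    have h := spread i j (by lia)
    have key : ∀ a : ZMod N, a.val = 1 → a = 1 := by
      intro a ha
      rw [← ZMod.natCast_zmod_val a, ha, Nat.cast_one]
    rw [h1, cycDist] at h
    rcases min_eq_iff.mp h with ⟨h, -⟩ | ⟨h, -⟩
    · exact hji (by rw [← key _ h]; ring)
    · exact hij (by rw [← key _ h]; ring)
  spread := spread

theorem IsCircuitCode.length_le {n k N : ℕ} {C : ZMod N → (Fin n → Bool)}
    (hC : IsCircuitCode n k N C) : N ≤ 2 ^ n := by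
  rcases N.eq_zero_or_pos with rfl | hN
  · exact Nat.zero_le _
  · have : NeZero N := ⟨hN.ne'⟩
    simpa [ZMod.card] using Fintype.card_le_of_injective C hC.inj

theorem ExistsCircuitCode.le_K {n k N : ℕ} (h : ExistsCircuitCode n k N) : N ≤ K n k :=
  le_csSup ⟨2 ^ n, fun _ ⟨_, hC⟩ => hC.length_le⟩ h

/-- Evaluates a Boolean predicate at all naturals below a bound. -/
def allBelow (p : ℕ → Bool) (n : ℕ) : Bool :=
  n.rec true fun k b => p k && b

theorem of_allBelow {p : ℕ → Bool} {n : ℕ} (h : allBelow p n = true) {i : ℕ} (hi : i < n) :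
    p i = true := by
  induction n with
  | zero => lia
  | succ n ih =>
    change (p n && allBelow p n) = true at h
    rw [Bool.and_eq_true] at h
    rcases Nat.lt_succ_iff_lt_or_eq.mp hi with hi | rfl
    · exact ih h.2 hi
    · exact h.1

/-- The number of ones among the `m` lowest binary digits of `x`. -/
def lowBitCount (x m : ℕ) : ℕ :=
  m.rec 0 fun k c => Nat.add c (Nat.land (Nat.shiftRight x k) 1)

theorem hammingDist_testBit (m x y : ℕ) :
    hammingDist (fun b : Fin m => x.testBit b) (fun b : Fin m => y.testBit b) =
      lowBitCount (Nat.xor x y) m := by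
  have key : ∀ m : ℕ, lowBitCount (Nat.xor x y) m =
      ∑ b ∈ Finset.range m, if x.testBit b ≠ y.testBit b then 1 else 0 := by
    intro m
    induction m with
    | zero => rfl
    | succ m ih =>
      rw [Finset.sum_range_succ, ← ih]
      change lowBitCount (Nat.xor x y) m + (((x ^^^ y) >>> m) &&& 1) = _
      congr 1
      have h : ((x ^^^ y) >>> m) &&& 1 = ((x ^^^ y).testBit m).toNat := by
        rw [Nat.and_one_is_mod, Nat.toNat_testBit, Nat.shiftRight_eq_div_pow]
      rw [h, Nat.testBit_xor]
      cases x.testBit m <;> cases y.testBit m <;> rfl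
  rw [key, ← Fin.sum_univ_eq_sum_range (fun b => if x.testBit b ≠ y.testBit b then 1 else 0) m,
    hammingDist, Finset.card_filter]

/-- The vertices of a `(22, 7)` circuit code of length `234`, concatenated in blocks of `22` bits.
The code is invariant under an affine automorphism of the hypercube which advances it by `13`
positions and permutes the coordinates in cycles of lengths `9`, `9`, `3` and `1`. -/
def packedCode : ℕ :=
  2519925991604754584586062855496072103930271927495242464793294407342782868059351089483461149529934092175980098440145467208111318895236600595781716637362766694954671256310821289061447038440513064256559720035347082267643824479778935239808383464285802481386717634666182002640531387455833153347028172782377797272132092298195029444272350823022243110231854196925000060783640249264760062912986813449626208517521540217200917407225921412774065683776620788635707577753152301440951933452635471420167167137496059721854533858762901441257296496744492269270735795851964777286868338635404752246256997344523688244301428376798953032091764447841957512935094110497017142096595969842731643238312544765754256358076662584471394630137219122660138074940120056693709304957140626455515462435480229449080518510037352271262228814257166729878953349263046239666785076744901290126887755330868366674140255264115845024230106418692002453474088775329494917863702605009835993104017715682401385292783623936489121102837775487898839994290079399202046332120130809174000471846685031904033214589110142322076035649819375746410680154854101799487938102148620840627687951563162535704315356220254008633679593891997246810523960283751004058130064541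4166264259988265008314464642743968843413417547521649326923248733969958773067346651248351296713723290644211639392328234796264565092516231628034789650324328927569464290265603035456678952842194305844779277124023655599055148926292412984375282952894994176125436822411980489249733178564075216672734233950529649461103346342405515202759788776761843168103628800

/-- A natural number whose lowest `22` bits are the `i`-th block of `packedCode`. -/
def packedVertex (i : ℕ) : ℕ := Nat.shiftRight packedCode (Nat.mul 22 i)

/-- The Hamming distance of the `i`-th and the `j`-th block of `packedCode`. -/
def packedDist (i j : ℕ) : ℕ := lowBitCount (Nat.xor (packedVertex i) (packedVertex j)) 22

/-- For positions `i`, `i + d` on a cycle of length `234` with vertices at Hamming distance `h`: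
either `h` is the cyclic distance, or `h` is at least `7` and the positions are not consecutive. -/
def goodPair (d h : ℕ) : Bool :=
  (Nat.ble 7 h && Nat.ble 2 d && Nat.ble d 232) ||
    (Nat.beq h d && Nat.ble d 117) || (Nat.beq h (Nat.sub 234 d) && Nat.ble 117 d)

theorem allBelow_goodPair :
    allBelow (fun i => allBelow (fun j => goodPair (Nat.sub i j) (packedDist i j)) i) 234 = true := by
  decide +kernel

/-- The circuit code stored in `packedCode`. -/
def code (i : ZMod 234) : Fin 22 → Bool := fun b => (packedVertex i.val).testBit b

theorem cycDist_eq_of_val_lt {N : ℕ} [NeZero N] {i j : ZMod N} (h : j.val < i.val) :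
    cycDist i j = min (i.val - j.val) (N - (i.val - j.val)) := by
  have hsub : (i - j).val = i.val - j.val := ZMod.val_sub h.le
  have hne : NeZero (i - j) := ⟨fun h0 => by rw [h0, ZMod.val_zero] at hsub; lia⟩
  rw [cycDist, ← neg_sub i j, ZMod.val_neg_of_ne_zero, hsub, min_comm]

theorem cycDist_comm {N : ℕ} (i j : ZMod N) : cycDist i j = cycDist j i :=
  min_comm _ _

theorem cycDist_self {N : ℕ} (i : ZMod N) : cycDist i i = 0 := by
  simp [cycDist]

theorem cycDist_add_one {N : ℕ} (hN : 2 ≤ N) (i : ZMod N) : cycDist i (i + 1) = 1 := by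
  have : Fact (1 < N) := ⟨hN⟩
  have : NeZero N := ⟨by lia⟩
  have : NeZero (1 : ZMod N) := ⟨one_ne_zero⟩
  rw [cycDist, add_sub_cancel_left, sub_add_cancel_left, ZMod.val_neg_of_ne_zero, ZMod.val_one]
  lia

theorem hammingDist_code (i j : ZMod 234) :
    hammingDist (code i) (code j) = cycDist i j ∨
      7 ≤ hammingDist (code i) (code j) ∧ 2 ≤ cycDist i j := by
  wlog hij : j.val ≤ i.val generalizing i j
  · rw [hammingDist_comm, cycDist_comm]
    exact this j i (by lia)
  rcases hij.eq_or_lt with h | h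
  · rw [ZMod.val_injective 234 h, hammingDist_self, cycDist_self]
    exact Or.inl rfl
  · have hgood := of_allBelow (of_allBelow allBelow_goodPair i.val_lt) h
    have hdist : packedDist i.val j.val = hammingDist (code i) (code j) :=
      (hammingDist_testBit 22 _ _).symm
    rw [hdist] at hgood
    have hi := i.val_lt
    rw [cycDist_eq_of_val_lt h]
    simp only [goodPair, Nat.sub_eq, Bool.or_eq_true, Bool.and_eq_true, Nat.ble_eq,
      Nat.beq_eq] at hgood
    lia

theorem isCircuitCode_code : IsCircuitCode 22 7 234 code := by
  refine .of_adj_of_spread (by norm_num) (fun i => ?_) (fun i j h => ?_)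
  · have h1 := cycDist_add_one (by norm_num) i
    have := hammingDist_code i (i + 1)
    lia
  · have := hammingDist_code i j
    lia

theorem stmt_13 : 234 ≤ K 22 7 ∧ ExistsCircuitCode 22 7 234 :=
  have h : ExistsCircuitCode 22 7 234 := ⟨code, isCircuitCode_code⟩
  ⟨h.le_K, h⟩
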